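/- Fix integers n, q, S ≥ 1 and a real σ > 0. Let (Ω, F, P) be a probability space carrying measurable random matrices C: Ω → ℝ^{n×n} and D: Ω → ℝ^{n×(qS)} and a square-integrable random vector γ: Ω → ℝ^{qS} that is independent of the pair (C, D), with E[γ] = 0 and E‖γ‖² ≤ qSσ², and almost surely ‖C‖_F ≤ √n, ‖D‖_F ≤ √(2qS), 𝟙ₙᵀC = 𝟙ₙᵀ, 𝟙ₙᵀD = 0. Then for every x₀ ∈ ℝⁿ, E‖C x₀ + D γ − (1/n)𝟙ₙ𝟙ₙᵀ x₀‖² ≤ n‖x₀‖² + 2q²S²σ² − (1/n)(𝟙ₙᵀ x₀)². -/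

import Mathlib

open MeasureTheory ProbabilityTheory Matrix

/-- Matrices over `ℝ` carry the product (entrywise) measurable structure. -/
instance matrixMeasurableSpace (m n : Type*) : MeasurableSpace (Matrix m n ℝ) :=
  inferInstanceAs (MeasurableSpace (m → n → ℝ))

theorem measurable_matrix_apply {m n : Type*} (i : m) (j : n) :
    Measurable fun A : Matrix m n ℝ => A i j :=
  (measurable_pi_apply j).comp (measurable_pi_apply (X := fun _ : m => n → ℝ) i)

theorem sum_mulVec_sq_le {m n : Type*} [Fintype m] [Fintype n] (A : Matrix m n ℝ) (v : n → ℝ) :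
    ∑ i, (A.mulVec v i) ^ 2 ≤ (∑ i, ∑ j, (A i j) ^ 2) * ∑ j, (v j) ^ 2 := by
  rw [Finset.sum_mul]
  exact Finset.sum_le_sum fun i _ => Finset.sum_mul_sq_le_sq_mul_sq Finset.univ (A i) v

theorem sum_mulVec_eq {m n : Type*} [Fintype m] [Fintype n] (A : Matrix m n ℝ) (v : n → ℝ) (c : ℝ)
    (h : ∀ j, ∑ i, A i j = c) : ∑ i, A.mulVec v i = c * ∑ j, v j := by
  simp only [Matrix.mulVec, dotProduct]
  rw [Finset.sum_comm, Finset.mul_sum]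
  exact Finset.sum_congr rfl fun j _ => by rw [← Finset.sum_mul, h j]

theorem sum_mul_mulVec {m n : Type*} [Fintype m] [Fintype n] (u : m → ℝ) (A : Matrix m n ℝ)
    (v : n → ℝ) : ∑ i, u i * A.mulVec v i = ∑ j, (∑ i, u i * A i j) * v j := by
  simp only [Matrix.mulVec, dotProduct, Finset.mul_sum, Finset.sum_mul]
  rw [Finset.sum_comm]
  exact Finset.sum_congr rfl fun j _ => Finset.sum_congr rfl fun i _ => by ring

theorem sum_add_sub_mean_sq {n : ℕ} (hn : 1 ≤ n) (u w : Fin n → ℝ) (s : ℝ)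
    (hu : ∑ i, u i = s) (hw : ∑ i, w i = 0) :
    ∑ i, (u i + w i - s / n) ^ 2 =
      ∑ i, (u i) ^ 2 + ∑ i, (w i) ^ 2 + 2 * ∑ i, u i * w i - (1 / n) * s ^ 2 := by
  have hn0 : (n : ℝ) ≠ 0 := by positivity
  have e : ∀ i, (u i + w i - s / n) ^ 2 = (u i) ^ 2 + (w i) ^ 2 + 2 * (u i * w i)
      - 2 * (s / n) * u i - 2 * (s / n) * w i + (s / n) ^ 2 := fun i => by ring
  simp only [e, Finset.sum_add_distrib, Finset.sum_sub_distrib, ← Finset.mul_sum, hu, hw,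
    Finset.sum_const, Finset.card_univ, Fintype.card_fin, nsmul_eq_mul]
  field_simp
  ring

/-- The intermediate bound (eq. iii_5) in the proof of Lemma 3 of the paper:
under the PPSC hypotheses on the random matrices `C, D` (Frobenius norms
`‖C‖_F ≤ √n`, `‖D‖_F ≤ √(2qS)` and column sums `𝟙ᵀC = 𝟙ᵀ`, `𝟙ᵀD = 0` almost
surely) and the noise `γ` (centered, square-integrable, total variance
`≤ qSσ²`, independent of `(C, D)`), the mean-square deviation of `Cx₀ + Dγ`
from the average of `x₀` is at most `n‖x₀‖² + 2q²S²σ² − (1/n)(𝟙ᵀx₀)²`. -/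
theorem stmt10 (n q S : ℕ) (hn : 1 ≤ n) (hq : 1 ≤ q) (hS : 1 ≤ S)
    (σ : ℝ) (hσ : 0 < σ)
    {Ω : Type*} [MeasurableSpace Ω] (P : Measure Ω) [IsProbabilityMeasure P]
    (C : Ω → Matrix (Fin n) (Fin n) ℝ) (D : Ω → Matrix (Fin n) (Fin (q * S)) ℝ)
    (γ : Ω → Fin (q * S) → ℝ)
    (hCm : Measurable C) (hDm : Measurable D) (hγm : Measurable γ)
    (hγ2 : Integrable (fun ω => ∑ i, (γ ω i) ^ 2) P)
    (hindep : IndepFun (fun ω => (C ω, D ω)) γ P)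
    (hγ0 : ∀ i, ∫ ω, γ ω i ∂P = 0)
    (hγvar : ∫ ω, ∑ i, (γ ω i) ^ 2 ∂P ≤ q * S * σ ^ 2)
    (hCF : ∀ᵐ ω ∂P, Real.sqrt (∑ i, ∑ j, (C ω i j) ^ 2) ≤ Real.sqrt n)
    (hDF : ∀ᵐ ω ∂P, Real.sqrt (∑ i, ∑ j, (D ω i j) ^ 2) ≤ Real.sqrt (2 * q * S))
    (hC1 : ∀ᵐ ω ∂P, ∀ j, ∑ i, C ω i j = 1)
    (hD1 : ∀ᵐ ω ∂P, ∀ j, ∑ i, D ω i j = 0) :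
    ∀ x₀ : Fin n → ℝ,
      ∫ ω, ∑ i, ((C ω).mulVec x₀ i + (D ω).mulVec (γ ω) i - (∑ j, x₀ j) / n) ^ 2 ∂P
        ≤ (n : ℝ) * ∑ i, (x₀ i) ^ 2 + 2 * q ^ 2 * S ^ 2 * σ ^ 2
            - (1 / n) * (∑ j, x₀ j) ^ 2 := by
  intro x₀
  have hF {m k : ℕ} {A : Matrix (Fin m) (Fin k) ℝ} {c : ℝ} (hc : 0 ≤ c)
      (h : Real.sqrt (∑ i, ∑ j, (A i j) ^ 2) ≤ Real.sqrt c) : ∑ i, ∑ j, (A i j) ^ 2 ≤ c :=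
    (Real.sqrt_le_sqrt_iff hc).1 h
  set φ : Fin (q * S) → Matrix (Fin n) (Fin n) ℝ × Matrix (Fin n) (Fin (q * S)) ℝ → ℝ :=
    fun j p => ∑ i, p.1.mulVec x₀ i * p.2 i j with hφ
  have hφm (j) : Measurable (φ j) := by
    refine Finset.measurable_sum _ fun i _ => Measurable.mul ?_ ?_
    · simp only [Matrix.mulVec, dotProduct]
      exact Finset.measurable_sum _ fun k _ =>
        ((measurable_matrix_apply i k).comp measurable_fst).mul_const _
    · exact (measurable_matrix_apply i j).comp measurable_snd
  have hγi (j) : Integrable (fun ω => γ ω j) P := by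
    have hm : Measurable fun ω => γ ω j := (measurable_pi_apply j).comp hγm
    refine ((integrable_const (1 : ℝ)).add hγ2).mono' hm.aestronglyMeasurable
      (ae_of_all _ fun ω => ?_)
    have h1 : (γ ω j) ^ 2 ≤ ∑ i, (γ ω i) ^ 2 :=
      Finset.single_le_sum (f := fun i => (γ ω i) ^ 2) (fun i _ => sq_nonneg _) (Finset.mem_univ j)
    simp only [Pi.add_apply, Real.norm_eq_abs]
    nlinarith [sq_abs (γ ω j), sq_nonneg (|γ ω j| - 1), sq_nonneg (|γ ω j|)]
  have hhi (j) : Integrable (fun ω => φ j (C ω, D ω)) P := by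
    have hm : Measurable fun ω => φ j (C ω, D ω) := (hφm j).comp (hCm.prodMk hDm)
    refine Integrable.of_bound hm.aestronglyMeasurable
      ((n * ∑ i, (x₀ i) ^ 2) + 2 * q * S) ?_
    filter_upwards [hCF, hDF] with ω h1 h2
    replace h1 := hF (by positivity) h1
    replace h2 := hF (by positivity) h2
    have h3 := (sum_mulVec_sq_le (C ω) x₀).trans
      (mul_le_mul_of_nonneg_right h1 (Finset.sum_nonneg fun i _ => sq_nonneg (x₀ i)))
    have h4 : ∑ i, (D ω i j) ^ 2 ≤ ∑ i, ∑ k, (D ω i k) ^ 2 := Finset.sum_le_sum fun i _ =>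
      Finset.single_le_sum (f := fun k => (D ω i k) ^ 2) (fun _ _ => sq_nonneg _)
        (Finset.mem_univ j)
    calc ‖φ j (C ω, D ω)‖ ≤ ∑ i, ‖(C ω).mulVec x₀ i * D ω i j‖ := norm_sum_le _ _
      _ ≤ ∑ i, (((C ω).mulVec x₀ i) ^ 2 + (D ω i j) ^ 2) := Finset.sum_le_sum fun i _ => by
          rw [Real.norm_eq_abs, abs_le]
          constructor <;> nlinarith [sq_nonneg ((C ω).mulVec x₀ i + D ω i j),
            sq_nonneg ((C ω).mulVec x₀ i - D ω i j), sq_nonneg ((C ω).mulVec x₀ i),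
            sq_nonneg (D ω i j)]
      _ ≤ _ := by rw [Finset.sum_add_distrib]; linarith
  have hind (j) : IndepFun (fun ω => φ j (C ω, D ω)) (fun ω => γ ω j) P :=
    hindep.comp (hφm j) (measurable_pi_apply j)
  have hci (j) : Integrable (fun ω => φ j (C ω, D ω) * γ ω j) P :=
    (hind j).integrable_mul (hhi j) (hγi j)
  have hc0 (j) : ∫ ω, φ j (C ω, D ω) * γ ω j ∂P = 0 := by
    rw [(hind j).integral_fun_mul_eq_mul_integral (hhi j).aestronglyMeasurable
      (hγi j).aestronglyMeasurable, hγ0 j, mul_zero]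
  have hsum : Integrable (fun ω => ∑ j, φ j (C ω, D ω) * γ ω j) P :=
    integrable_finsetSum _ fun j _ => hci j
  set K : ℝ := n * ∑ i, (x₀ i) ^ 2 - (1 / n) * (∑ j, x₀ j) ^ 2 with hK
  have hcross : ∫ ω, ∑ j, φ j (C ω, D ω) * γ ω j ∂P = 0 := by
    rw [integral_finsetSum _ fun j _ => hci j]
    simp only [hc0, Finset.sum_const_zero]
  have hA : Integrable (fun ω => K + 2 * q * S * ∑ i, (γ ω i) ^ 2) P :=
    (integrable_const K).add (hγ2.const_mul _)
  calc _ ≤ ∫ ω, (K + 2 * q * S * ∑ i, (γ ω i) ^ 2) + 2 * ∑ j, φ j (C ω, D ω) * γ ω j ∂P := by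
        refine integral_mono_of_nonneg
          (ae_of_all _ fun ω => Finset.sum_nonneg fun i _ => sq_nonneg _)
          (hA.add (hsum.const_mul 2)) ?_
        filter_upwards [hCF, hDF, hC1, hD1] with ω h1 h2 h3 h4
        have h5 := (sum_mulVec_sq_le (C ω) x₀).trans (mul_le_mul_of_nonneg_right
          (hF (by positivity) h1) (Finset.sum_nonneg fun i _ => sq_nonneg (x₀ i)))
        have h6 := (sum_mulVec_sq_le (D ω) (γ ω)).trans (mul_le_mul_of_nonneg_right
          (hF (by positivity) h2) (Finset.sum_nonneg fun i _ => sq_nonneg (γ ω i)))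
        rw [sum_add_sub_mean_sq hn _ _ _ ((sum_mulVec_eq _ _ 1 h3).trans (one_mul _))
          ((sum_mulVec_eq _ _ 0 h4).trans (zero_mul _)), sum_mul_mulVec]
        linarith
    _ = K + 2 * q * S * ∫ ω, ∑ i, (γ ω i) ^ 2 ∂P := by
        rw [integral_add hA (hsum.const_mul 2),
          integral_add (integrable_const K) (hγ2.const_mul _), integral_const_mul,
          integral_const_mul, hcross]
        simp
    _ ≤ K + 2 * q * S * (q * S * σ ^ 2) := by gcongr
    _ = _ := by rw [hK]; ring
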